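/- Let c and c′ be nonempty lists of integers with every entry ≥ 2, and suppose s(c) = s(c′) = p and r(c) + r(c′) ≡ 0 (mod p). Then 𝓢(c′) equals the reciprocal polynomial 𝓢(c)^∨ of 𝓢(c). (In the notation of q-deformed rationals: if a/p and b/p are irreducible fractions with a ≡ −b (mod p), then 𝓢_{a/p}(q) = 𝓢_{b/p}^∨(q).) -/

import Mathlib

open Polynomial

/-- The `q`-deformation `[n]_q = 1 + q + ⋯ + q^{n-1}` of a nonnegative integer. -/
noncomputable def qNat (n : ℕ) : Polynomial ℤ := (Finset.range n).sum fun i => X ^ i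

/-- The matrix `M_q⁻(c) = (([c]_q, -q^{c-1}), (1, 0))` over `ℤ[q]`. -/
noncomputable def MqNeg (c : ℕ) : Matrix (Fin 2) (Fin 2) (Polynomial ℤ) :=
  !![qNat c, -(X ^ (c - 1)); 1, 0]

/-- `𝓡(c)`: the (0,0) entry of `M_q⁻(c₁)⋯M_q⁻(c_l)`. -/
noncomputable def Rpoly (L : List ℕ) : Polynomial ℤ := ((L.map MqNeg).prod) 0 0

/-- `𝓢(c)`: the (1,0) entry of `M_q⁻(c₁)⋯M_q⁻(c_l)`. -/
noncomputable def Spoly (L : List ℕ) : Polynomial ℤ := ((L.map MqNeg).prod) 1 0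

/-- `r(c) = 𝓡(c)(1)`. -/
noncomputable def rNum (L : List ℕ) : ℤ := (Rpoly L).eval 1

/-- `s(c) = 𝓢(c)(1)`. -/
noncomputable def sNum (L : List ℕ) : ℤ := (Spoly L).eval 1

@[simp] theorem Rpoly_nil : Rpoly [] = 1 := by simp [Rpoly]

@[simp] theorem Spoly_nil : Spoly [] = 0 := by simp [Spoly]

theorem Rpoly_cons (c : ℕ) (T : List ℕ) :
    Rpoly (c :: T) = qNat c * Rpoly T - X ^ (c - 1) * Spoly T := by
  simp [Rpoly, Spoly, MqNeg, Matrix.mul_apply, Fin.sum_univ_two, sub_eq_add_neg]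

@[simp] theorem Spoly_cons (c : ℕ) (T : List ℕ) : Spoly (c :: T) = Rpoly T := by
  simp [Rpoly, Spoly, MqNeg, Matrix.mul_apply, Fin.sum_univ_two]

@[simp] theorem rNum_nil : rNum [] = 1 := by simp [rNum]

@[simp] theorem sNum_nil : sNum [] = 0 := by simp [sNum]

@[simp] theorem rNum_cons (c : ℕ) (T : List ℕ) :
    rNum (c :: T) = c * rNum T - sNum T := by
  simp [rNum, sNum, Rpoly_cons, qNat, eval_finsetSum]

@[simp] theorem sNum_cons (c : ℕ) (T : List ℕ) : sNum (c :: T) = rNum T := by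
  simp [rNum, sNum]

theorem sNum_nonneg_and_lt_rNum (T : List ℕ) (hT : ∀ y ∈ T, 2 ≤ y) :
    0 ≤ sNum T ∧ sNum T < rNum T := by
  induction T with
  | nil => simp
  | cons c T ih =>
    obtain ⟨h0, h1⟩ := ih fun y hy => hT y (by simp [hy])
    have hc : (2 : ℤ) ≤ c := by exact_mod_cast hT c (by simp)
    simp only [sNum_cons, rNum_cons]
    constructor <;> nlinarith

theorem coeff_zero_Rpoly (T : List ℕ) (hT : ∀ y ∈ T, 2 ≤ y) : (Rpoly T).coeff 0 = 1 := by
  induction T with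
  | nil => simp
  | cons c T ih =>
    obtain ⟨k, rfl⟩ : ∃ k, c = k + 2 := ⟨c - 2, by have := hT c (by simp); omega⟩
    simp [Rpoly_cons, mul_coeff_zero, ih fun y hy => hT y (by simp [hy]), qNat,
      Finset.sum_range_succ']

theorem Rpoly_succ_cons (c : ℕ) (hc : 1 ≤ c) (T : List ℕ) :
    Rpoly ((c + 1) :: T) = X * Rpoly (c :: T) + Rpoly T := by
  obtain ⟨k, rfl⟩ : ∃ k, c = k + 1 := ⟨c - 1, by omega⟩
  have h : qNat (k + 1 + 1) = X * qNat (k + 1) + 1 := by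
    simp [qNat, Finset.sum_range_succ' _ (k + 1), Finset.mul_sum, pow_succ']
  rw [Rpoly_cons, Rpoly_cons, h]
  simp only [Nat.add_sub_cancel]
  ring

theorem Rpoly_two_cons (T : List ℕ) :
    Rpoly (2 :: T) = (1 + X) * Rpoly T - X * Spoly T := by
  simp [Rpoly_cons, qNat, Finset.sum_range_succ]

/-- The lists `T` and `U` have reciprocal numerators with respect to degree `d`, and the
denominator of `U` is the reflection of numerator minus denominator of `T`. -/
structure QDual (d : ℕ) (T U : List ℕ) : Prop where
  natDegree_R_left : (Rpoly T).natDegree ≤ d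
  natDegree_S_left : (Spoly T).natDegree ≤ d
  natDegree_R_right : (Rpoly U).natDegree ≤ d
  natDegree_S_right : (Spoly U).natDegree ≤ d
  R_eq : Rpoly U = (Rpoly T).reflect d
  S_eq : Spoly U = (Rpoly T - Spoly T).reflect d

namespace QDual

theorem symm {d : ℕ} {T U : List ℕ} (h : QDual d T U) : QDual d U T where
  natDegree_R_left := h.natDegree_R_right
  natDegree_S_left := h.natDegree_S_right
  natDegree_R_right := h.natDegree_R_left
  natDegree_S_right := h.natDegree_S_left
  R_eq := by rw [h.R_eq, reflect_reflect]
  S_eq := by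
    rw [h.R_eq, h.S_eq, ← reflect_sub, reflect_reflect]
    ring

theorem two_two : QDual 1 [2] [2] := by
  have hR : Rpoly [2] = 1 + X := by simp [Rpoly_two_cons]
  have hd : (1 + X : ℤ[X]).natDegree ≤ 1 := by compute_degree
  constructor <;> simp only [hR, Spoly_cons, Rpoly_nil]
  · exact hd
  · simp
  · exact hd
  · simp
  · rw [reflect_add]
    simp [reflect_one, add_comm]
  · simp

theorem succ_cons {d c : ℕ} {T U : List ℕ} (hc : 1 ≤ c) (h : QDual d (c :: T) U) :
    QDual (d + 1) ((c + 1) :: T) (2 :: U) := by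
  have h1 := h.natDegree_R_left
  have h2 := h.natDegree_S_left
  have h3 := h.natDegree_R_right
  have h4 := h.natDegree_S_right
  have h5 := h.R_eq
  have h6 := h.S_eq
  rw [Spoly_cons] at h2 h6
  have reflect_X_mul (f : ℤ[X]) (hf : f.natDegree ≤ d) :
      (X * f).reflect (d + 1) = f.reflect d := by
    rw [add_comm d 1, reflect_mul X f natDegree_X_le hf]
    simp
  have reflect_succ (f : ℤ[X]) (hf : f.natDegree ≤ d) :
      f.reflect (d + 1) = X * f.reflect d := by
    have := reflect_mul (1 : ℤ[X]) f (F := 1) (by simp) hf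
    simpa [add_comm, reflect_one] using this
  have natDegree_X_mul (f : ℤ[X]) (hf : f.natDegree ≤ d) : (X * f).natDegree ≤ d + 1 := by
    rw [add_comm]
    exact natDegree_mul_le_of_le natDegree_X_le hf
  constructor <;> simp only [Spoly_cons, Rpoly_succ_cons c hc, Rpoly_two_cons]
  · exact natDegree_add_le_of_degree_le (natDegree_X_mul _ h1) (by omega)
  · omega
  · rw [add_mul, one_mul]
    exact (natDegree_sub_le_iff_left (natDegree_X_mul _ h4)).2
      (natDegree_add_le_of_degree_le (by omega) (natDegree_X_mul _ h3))
  · omega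
  · rw [reflect_add, reflect_X_mul _ h1, reflect_succ _ h2, h6, h5, reflect_sub]
    ring
  · rw [add_sub_cancel_right, reflect_X_mul _ h1, h5]

theorem reverse_eq {d : ℕ} {T U : List ℕ} (h : QDual d T U) (hU : ∀ y ∈ U, 2 ≤ y) :
    Rpoly U = (Rpoly T).reverse := by
  have hd : (Rpoly T).natDegree = d := by
    refine le_antisymm h.natDegree_R_left (le_natDegree_of_ne_zero ?_)
    have h0 := coeff_zero_Rpoly U hU
    rw [h.R_eq, coeff_reflect, revAt_zero] at h0
    simp [h0]
  rw [reverse, hd, h.R_eq]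

end QDual

/-- Lists whose continued fractions `α`, `β` satisfy `1/α + 1/β = 1` are dual. -/
theorem exists_qDual (n : ℕ) : ∀ T U : List ℕ, T.sum + U.sum ≤ n →
    (∀ y ∈ T, 2 ≤ y) → (∀ y ∈ U, 2 ≤ y) → T ≠ [] → U ≠ [] →
    rNum T = rNum U → sNum T + sNum U = rNum T → ∃ d, QDual d T U := by
  induction n with
  | zero =>
    intro T U hn hT _ hT0
    obtain ⟨c, T, rfl⟩ := List.exists_cons_of_ne_nil hT0
    have := hT c (by simp)
    simp at hn
    omega
  | succ n ih =>
    have step (c : ℕ) (hc : 2 ≤ c) (T U : List ℕ) (hn : c + 1 + T.sum + (2 + U.sum) ≤ n + 1)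
        (hT : ∀ y ∈ T, 2 ≤ y) (hU : ∀ y ∈ U, 2 ≤ y)
        (hr : rNum ((c + 1) :: T) = rNum (2 :: U))
        (hs : rNum T + rNum U = rNum ((c + 1) :: T)) :
        ∃ d, QDual d ((c + 1) :: T) (2 :: U) := by
      have hcT : ∀ y ∈ c :: T, 2 ≤ y := by simpa [hc] using hT
      have hb := sNum_nonneg_and_lt_rNum _ hcT
      simp only [rNum_cons, sNum_cons] at hr hs hb
      push_cast at hr hs
      have hU0 : U ≠ [] := by
        rintro rfl
        simp at hr hs
        linarith
      obtain ⟨d, hd⟩ := ih (c :: T) U (by simp; omega) hcT hU (by simp) hU0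
        (by simp only [rNum_cons]; linarith) (by simp only [rNum_cons, sNum_cons]; linarith)
      exact ⟨d + 1, hd.succ_cons (by omega)⟩
    intro T U hn hT hU hT0 hU0 hr hs
    obtain ⟨a, T, rfl⟩ := List.exists_cons_of_ne_nil hT0
    obtain ⟨b, U, rfl⟩ := List.exists_cons_of_ne_nil hU0
    obtain ⟨ha, hT'⟩ := List.forall_mem_cons.1 hT
    obtain ⟨hb, hU'⟩ := List.forall_mem_cons.1 hU
    simp only [List.sum_cons] at hn
    simp only [sNum_cons] at hs
    obtain ⟨hT1, hT2⟩ := sNum_nonneg_and_lt_rNum T hT'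
    obtain ⟨hU1, hU2⟩ := sNum_nonneg_and_lt_rNum U hU'
    rcases Nat.eq_or_lt_of_le ha with rfl | ha <;> rcases Nat.eq_or_lt_of_le hb with rfl | hb
    · have nil_of_sNum (V : List ℕ) (hV : ∀ y ∈ V, 2 ≤ y) (h : sNum V = 0) : V = [] := by
        cases V with
        | nil => rfl
        | cons v V =>
          have := sNum_nonneg_and_lt_rNum V fun y hy => hV y (by simp [hy])
          rw [sNum_cons] at h
          omega
      simp only [rNum_cons] at hr hs
      push_cast at hr hs
      rw [nil_of_sNum T hT' (by linarith), nil_of_sNum U hU' (by linarith)]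
      exact ⟨1, .two_two⟩
    · obtain ⟨c, rfl⟩ : ∃ c, b = c + 1 := ⟨b - 1, by omega⟩
      obtain ⟨d, hd⟩ := step c (by omega) U T (by omega) hU' hT' hr.symm (by linarith)
      exact ⟨d, hd.symm⟩
    · obtain ⟨c, rfl⟩ : ∃ c, a = c + 1 := ⟨a - 1, by omega⟩
      exact step c (by omega) T U (by omega) hT' hU' hr hs
    · have ha' : (3 : ℤ) ≤ a := by exact_mod_cast ha
      have hb' : (3 : ℤ) ≤ b := by exact_mod_cast hb
      simp only [rNum_cons] at hr hs
      have h1 : 3 * rNum T ≤ a * rNum T := by gcongr; linarith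
      have h2 : 3 * rNum U ≤ b * rNum U := by gcongr; linarith
      linarith

/-- If `a/p` and `b/p` are irreducible fractions (given by negative continued-fraction
lists `L`, `L'`) with `a ≡ −b (mod p)`, then `𝓢_{a/p}(q) = 𝓢_{b/p}^∨(q)`. -/
theorem stmt5 (p : ℤ) (L L' : List ℕ)
    (hL : L ≠ []) (hL2 : ∀ y ∈ L, 2 ≤ y)
    (hL' : L' ≠ []) (hL'2 : ∀ y ∈ L', 2 ≤ y)
    (hsL : sNum L = p) (hsL' : sNum L' = p)
    (hmod : rNum L + rNum L' ≡ 0 [ZMOD p]) :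
    Spoly L' = (Spoly L).reverse := by
  obtain ⟨a, T, rfl⟩ := List.exists_cons_of_ne_nil hL
  obtain ⟨b, U, rfl⟩ := List.exists_cons_of_ne_nil hL'
  have hT := (List.forall_mem_cons.1 hL2).2
  have hU := (List.forall_mem_cons.1 hL'2).2
  obtain ⟨hT1, hT2⟩ := sNum_nonneg_and_lt_rNum T hT
  obtain ⟨hU1, hU2⟩ := sNum_nonneg_and_lt_rNum U hU
  simp only [sNum_cons, rNum_cons, Spoly_cons] at *
  have hdvd : p ∣ sNum T + sNum U := by
    have h := Int.modEq_zero_iff_dvd.1 hmod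
    rw [hsL, hsL'] at h
    have : sNum T + sNum U = p * (a + b) - (a * p - sNum T + (b * p - sNum U)) := by ring
    rw [this]
    exact dvd_sub (dvd_mul_right _ _) h
  have sNum_pos (V : List ℕ) (hV : ∀ y ∈ V, 2 ≤ y) (h : V ≠ []) : 0 < sNum V := by
    obtain ⟨v, V, rfl⟩ := List.exists_cons_of_ne_nil h
    have := sNum_nonneg_and_lt_rNum V fun y hy => hV y (by simp [hy])
    rw [sNum_cons]
    omega
  by_cases hT0 : T = []
  · have hU0 : U = [] := by
      by_contra hU0
      have := sNum_pos U hU hU0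
      subst hT0
      simp at hsL
      omega
    rw [hT0, hU0, Rpoly_nil, ← C_1, reverse_C]
  have hTpos := sNum_pos T hT hT0
  have hU0 : U ≠ [] := by
    rintro rfl
    simp at hsL'
    omega
  have hsum : sNum T + sNum U = p := by
    obtain ⟨k, hk⟩ := hdvd
    have hk1 : k = 1 := by
      have : 0 < k := by by_contra! hk0; nlinarith
      have : k < 2 := by by_contra! hk0; nlinarith
      omega
    rw [hk, hk1, mul_one]
  obtain ⟨d, hd⟩ := exists_qDual _ T U le_rfl hT hU hT0 hU0 (by omega) (by omega)
  exact hd.reverse_eq hU
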